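/- For S = {s_1 < s_2 < … < s_k} ⊆ [n−1], the statistics inv and imaj (where imaj(π) = maj(π^{-1})) are equidistributed on the set of permutations π ∈ S_n with Des(π) ⊆ S, and the common generating function is the q-multinomial coefficient [n choose s_1, s_2 − s_1, …, n − s_k]_q; that is, Σ_{π : Des(π) ⊆ S} q^{inv(π)} = Σ_{π : Des(π) ⊆ S} q^{imaj(π)} = [n]!_q / ([s_1]!_q [s_2 − s_1]!_q ⋯ [n − s_k]!_q). -/

import Mathlib

open Polynomial

/-- The `q`-integer `[k]_q = 1 + q + ⋯ + q^{k-1}` as a polynomial in `q = X`. -/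
noncomputable def qint (k : ℕ) : Polynomial ℤ := ∑ i ∈ Finset.range k, X ^ i

/-- The `q`-factorial `[k]!_q`. -/
noncomputable def qfact : ℕ → Polynomial ℤ
  | 0 => 1
  | k + 1 => qint (k + 1) * qfact k

/-- The number of inversions of a word. -/
def inv {n : ℕ} {β : Type*} [LinearOrder β] (w : Fin n → β) : ℕ :=
  (Finset.univ.filter (fun p : Fin n × Fin n => p.1 < p.2 ∧ w p.2 < w p.1)).card

/-- The major index of a word (sum of 1-based descent positions). -/
def maj {n : ℕ} {β : Type*} [LinearOrder β] (w : Fin n → β) : ℕ :=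
  ∑ p ∈ Finset.univ.filter
      (fun p : Fin n × Fin n => (p.2 : ℕ) = (p.1 : ℕ) + 1 ∧ w p.2 < w p.1),
    ((p.1 : ℕ) + 1)

/-- `Des(π) ⊆ S` where `S = {s 1, …, s k}` (1-based positions). -/
def DesSubset (n k : ℕ) (s : ℕ → ℕ) (π : Equiv.Perm (Fin n)) : Prop :=
  ∀ p : Fin n × Fin n, (p.2 : ℕ) = (p.1 : ℕ) + 1 → π p.2 < π p.1 →
    ∃ j ∈ Finset.Icc 1 k, (p.1 : ℕ) + 1 = s j

instance (n k : ℕ) (s : ℕ → ℕ) : DecidablePred (DesSubset n k s) := fun _ => by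
  unfold DesSubset; infer_instance


/-! ### Words and their content -/

/-- The content of a word: how often each letter occurs. -/
def wcontent {n m : ℕ} (w : Fin n → Fin m) (a : Fin m) : ℕ :=
  ∑ i, if w i = a then 1 else 0

/-- Append a letter at the end of a word. -/
def app {n m : ℕ} (w : Fin n → Fin m) (x : Fin m) : Fin (n + 1) → Fin m :=
  Fin.snoc (α := fun _ => Fin m) w x

@[simp] lemma app_castSucc {n m : ℕ} (w : Fin n → Fin m) (x : Fin m) (i : Fin n) :
    app w x i.castSucc = w i := by simp [app]

@[simp] lemma app_last {n m : ℕ} (w : Fin n → Fin m) (x : Fin m) :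
    app w x (Fin.last n) = x := by simp [app]

lemma wcontent_app {n m : ℕ} (w : Fin n → Fin m) (x : Fin m) :
    wcontent (app w x) = wcontent w + Pi.single x 1 := by
  funext a
  simp only [wcontent, Fin.sum_univ_castSucc, app_castSucc, app_last, Pi.add_apply,
    Pi.single_apply, eq_comm (a := x)]

lemma inv_eq_sum {n : ℕ} {β : Type*} [LinearOrder β] (w : Fin n → β) :
    inv w = ∑ i, ∑ j, if i < j ∧ w j < w i then 1 else 0 := by
  rw [inv, Finset.card_filter, Fintype.sum_prod_type]

lemma maj_eq_sum {n : ℕ} {β : Type*} [LinearOrder β] (w : Fin n → β) :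
    maj w = ∑ i : Fin n, ∑ j : Fin n,
      if (j : ℕ) = (i : ℕ) + 1 ∧ w j < w i then (i : ℕ) + 1 else 0 := by
  rw [maj, Finset.sum_filter, Fintype.sum_prod_type]

lemma wcontent_sum {n m : ℕ} (w : Fin n → Fin m) (T : Finset (Fin m)) :
    ∑ a ∈ T, wcontent w a = ∑ i, if w i ∈ T then 1 else 0 := by
  simp only [wcontent]
  rw [Finset.sum_comm]
  refine Finset.sum_congr rfl fun i _ => ?_
  simp

lemma inv_app {n m : ℕ} (w : Fin n → Fin m) (x : Fin m) :
    inv (app w x) = inv w + ∑ a ∈ Finset.Ioi x, wcontent w a := by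
  rw [wcontent_sum, inv_eq_sum, inv_eq_sum, Fin.sum_univ_castSucc]
  simp only [Fin.sum_univ_castSucc, app_castSucc, app_last, Finset.sum_add_distrib]
  have h (i : Fin n) : ¬ Fin.last n < i.castSucc := by simp [Fin.le_last]
  simp [h, Fin.castSucc_lt_last]

lemma maj_app_app {n m : ℕ} (w : Fin n → Fin m) (y x : Fin m) :
    maj (app (app w y) x) = maj (app w y) + if x < y then n + 1 else 0 := by
  generalize hv : app w y = v
  have hy : y = v (Fin.last n) := by simp [← hv]
  subst hy
  rw [maj_eq_sum (app v x), maj_eq_sum v, Fin.sum_univ_castSucc]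
  have h1 (i : Fin (n + 1)) : ¬ ((i : ℕ) = n + 1 + 1) := by omega
  have h2 (i : Fin n) : ¬ (n = (i : ℕ)) := by omega
  have h3 : ∑ i : Fin (n + 1), (if n + 1 = (i : ℕ) + 1 ∧ x < v i then (i : ℕ) + 1 else 0)
      = if x < v (Fin.last n) then n + 1 else 0 := by
    rw [Fin.sum_univ_castSucc]
    simp [h2]
  rw [← h3]
  rw [← Finset.sum_add_distrib]
  have h4 : ∑ j : Fin (n + 1 + 1), (if (j : ℕ) = ((Fin.last (n + 1) : Fin (n + 1 + 1)) : ℕ) + 1 ∧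
      app v x j < app v x (Fin.last (n + 1)) then ((Fin.last (n + 1) : Fin (n + 1 + 1)) : ℕ) + 1 else 0) = 0 := by
    refine Finset.sum_eq_zero fun j _ => ?_
    rw [if_neg]
    simp only [Fin.val_last]
    omega
  rw [h4, add_zero]
  refine Finset.sum_congr rfl fun i _ => ?_
  rw [Fin.sum_univ_castSucc]
  simp

lemma maj_app_top {n m : ℕ} (w : Fin n → Fin (m + 1)) :
    maj (app w (Fin.last m)) = maj w := by
  rw [maj_eq_sum, maj_eq_sum, Fin.sum_univ_castSucc]
  have h (x : Fin (m + 1)) : ¬ Fin.last m < x := by simp [Fin.le_last]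
  have h1 (i : Fin n) : ¬ ((i : ℕ) = n + 1) := by omega
  simp [Fin.sum_univ_castSucc, h, h1]

/-! ### Identities of `q`-integers -/

lemma qint_add (a b : ℕ) : qint (a + b) = qint a + X ^ a * qint b := by
  simp [qint, Finset.sum_range_add, Finset.mul_sum, pow_add]

lemma qint_sum {m : ℕ} (β : Fin m → ℕ) (T : Finset (Fin m)) :
    ∑ y ∈ T, X ^ (∑ z ∈ T.filter (fun z => y < z), β z) * qint (β y) = qint (∑ y ∈ T, β y) := by
  induction T using Finset.induction_on_min with
  | empty => simp [qint]
  | insert a T ha ih =>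
    have hn : a ∉ T := fun h => lt_irrefl _ (ha a h)
    rw [Finset.sum_insert hn, Finset.sum_insert hn, add_comm (β a), qint_add, ← ih, add_comm]
    congr 1
    · refine Finset.sum_congr rfl fun y hy => ?_
      rw [Finset.filter_insert, if_neg (not_lt.2 (ha y hy).le)]
    · rw [Finset.filter_insert, if_neg (lt_irrefl a), Finset.filter_true_of_mem ha]

lemma qint_sum_univ {m : ℕ} (β : Fin m → ℕ) :
    ∑ y, X ^ (∑ z ∈ Finset.Ioi y, β z) * qint (β y) = qint (∑ y, β y) := by
  rw [← qint_sum]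
  refine Finset.sum_congr rfl fun y _ => ?_
  congr 3
  ext; simp

lemma qint_sum_split {m : ℕ} (β : Fin m → ℕ) (x : Fin m) :
    ∑ y, X ^ (if x < y then ∑ y, β y else 0) * (X ^ (∑ z ∈ Finset.Ioi y, β z) * qint (β y))
      = X ^ (∑ z ∈ Finset.Ioi x, β z) * qint (∑ y, β y) := by
  have hsplit : ∑ y, β y = ∑ y ∈ Finset.Iic x, β y + ∑ y ∈ Finset.Ioi x, β y := by
    rw [← Finset.sum_filter_add_sum_filter_not Finset.univ (fun y => y ≤ x)]
    congr 2 <;> ext <;> simp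
  have e1 : Finset.univ.filter (fun y => y ≤ x) = Finset.Iic x := by ext; simp
  have e2 : Finset.univ.filter (fun y => ¬ y ≤ x) = Finset.Ioi x := by ext; simp
  rw [← Finset.sum_filter_add_sum_filter_not Finset.univ (fun y => y ≤ x), e1, e2]
  have h1 : ∑ y ∈ Finset.Iic x, X ^ (if x < y then ∑ y, β y else 0) *
      (X ^ (∑ z ∈ Finset.Ioi y, β z) * qint (β y))
      = X ^ (∑ z ∈ Finset.Ioi x, β z) * qint (∑ y ∈ Finset.Iic x, β y) := by
    rw [← qint_sum, Finset.mul_sum]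
    refine Finset.sum_congr rfl fun y hy => ?_
    have hy' : y ≤ x := Finset.mem_Iic.1 hy
    rw [if_neg (not_lt.2 hy'), pow_zero, one_mul, ← mul_assoc, ← pow_add]
    congr 2
    rw [← Finset.sum_union]
    · congr 1
      ext z
      simp only [Finset.mem_Ioi, Finset.mem_union, Finset.mem_filter, Finset.mem_Iic]
      constructor
      · intro h
        rcases lt_or_ge x z with h' | h'
        · exact Or.inl h'
        · exact Or.inr ⟨h', h⟩
      · rintro (h | h)
        · exact lt_of_le_of_lt hy' h
        · exact h.2
    · rw [Finset.disjoint_left]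
      intro z hz hz'
      simp only [Finset.mem_Ioi, Finset.mem_filter, Finset.mem_Iic] at hz hz'
      exact absurd hz (not_lt.2 hz'.1)
  have h2 : ∑ y ∈ Finset.Ioi x, X ^ (if x < y then ∑ y, β y else 0) *
      (X ^ (∑ z ∈ Finset.Ioi y, β z) * qint (β y))
      = X ^ (∑ y, β y) * qint (∑ y ∈ Finset.Ioi x, β y) := by
    rw [← qint_sum, Finset.mul_sum]
    refine Finset.sum_congr rfl fun y hy => ?_
    have hy' : x < y := Finset.mem_Ioi.1 hy
    rw [if_pos hy']
    congr 4
    ext z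
    simp only [Finset.mem_Ioi, Finset.mem_filter]
    exact ⟨fun h => ⟨hy'.trans h, h⟩, fun h => h.2⟩
  rw [h1, h2, hsplit, qint_add, pow_add]
  ring

lemma qfact_succ_mul (k : ℕ) : qfact (k + 1) = qint (k + 1) * qfact k := rfl

lemma qint_ne_zero (k : ℕ) : qint (k + 1) ≠ 0 := by
  intro h
  have := congrArg (Polynomial.eval 1) h
  simp [qint, Polynomial.eval_finsetSum] at this
  omega

lemma qfact_ne_zero (k : ℕ) : qfact k ≠ 0 := by
  induction k with
  | zero => simp [qfact]
  | succ k ih => exact mul_ne_zero (qint_ne_zero k) ih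

lemma prod_qfact_add {m : ℕ} (β : Fin m → ℕ) (y : Fin m) :
    ∏ a, qfact ((β + Pi.single y 1 : Fin m → ℕ) a) = qint (β y + 1) * ∏ a, qfact (β a) := by
  rw [← Finset.mul_prod_erase Finset.univ _ (Finset.mem_univ y),
    ← Finset.mul_prod_erase Finset.univ (fun a => qfact (β a)) (Finset.mem_univ y)]
  have : ∏ a ∈ Finset.univ.erase y, qfact ((β + Pi.single y 1 : Fin m → ℕ) a)
      = ∏ a ∈ Finset.univ.erase y, qfact (β a) := by
    refine Finset.prod_congr rfl fun a ha => ?_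
    simp [Finset.ne_of_mem_erase ha]
  rw [this]
  simp [qfact_succ_mul, mul_assoc]

lemma sum_words_succ {n m : ℕ} (F : (Fin (n + 1) → Fin m) → Polynomial ℤ) :
    ∑ w, F w = ∑ y, ∑ w : Fin n → Fin m, F (app w y) := by
  rw [← (Fin.snocEquiv (fun _ : Fin (n + 1) => Fin m)).sum_comp, Fintype.sum_prod_type]
  rfl

/-- The generic recursion, covering both statistics. -/
lemma generic {m : ℕ} (f : ∀ n, (Fin n → Fin m) → ℕ)
    (e : (Fin m → ℕ) → Fin m → Fin m → ℕ)
    (h0 : ∀ (w : Fin 0 → Fin m) x, f 1 (app w x) = 0)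
    (hf : ∀ n (w : Fin n → Fin m) y x,
      f (n + 2) (app (app w y) x) = f (n + 1) (app w y) + e (wcontent (app w y)) x y)
    (he : ∀ β x, ∑ y, X ^ (e β x y) * (X ^ (∑ z ∈ Finset.Ioi y, β z) * qint (β y))
      = X ^ (∑ z ∈ Finset.Ioi x, β z) * qint (∑ y, β y))
    (n : ℕ) (β : Fin m → ℕ) (hβ : ∑ a, β a = n) (x : Fin m) :
    (∑ w : Fin n → Fin m, if wcontent w = β then (X : Polynomial ℤ) ^ f (n + 1) (app w x) else 0)
      * ∏ a, qfact (β a) = X ^ (∑ z ∈ Finset.Ioi x, β z) * qfact n := by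
  induction n generalizing β x with
  | zero =>
    have hz : β = 0 := by
      funext a
      simpa using (Finset.sum_eq_zero_iff.1 hβ) a (Finset.mem_univ a)
    subst hz
    have : ∀ w : Fin 0 → Fin m, wcontent w = 0 := fun w => by funext a; simp [wcontent]
    simp [this, h0, qfact]
  | succ n ih =>
    rw [sum_words_succ, Finset.sum_mul]
    have key : ∀ y, (∑ w : Fin n → Fin m, if wcontent (app w y) = β then
        (X : Polynomial ℤ) ^ f (n + 1 + 1) (app (app w y) x) else 0) * ∏ a, qfact (β a)
        = (X ^ (e β x y) * (X ^ (∑ z ∈ Finset.Ioi y, β z) * qint (β y))) * qfact n := by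
      intro y
      rcases Nat.eq_zero_or_pos (β y) with hy | hy
      · have : ∀ w : Fin n → Fin m, wcontent (app w y) ≠ β := by
          intro w h
          have := congrFun h y
          rw [wcontent_app, hy] at this
          simp at this
        simp [this, hy, qint]
      · obtain ⟨γ, rfl⟩ : ∃ γ : Fin m → ℕ, β = γ + Pi.single y 1 := by
          refine ⟨β - Pi.single y 1, ?_⟩
          funext a
          by_cases h : a = y
          · subst h; simp; omega
          · simp [h]
        have hγ : ∑ a, γ a = n := by
          simpa [Finset.sum_add_distrib] using hβ
        have h1 : (∑ w : Fin n → Fin m, if wcontent (app w y) = γ + Pi.single y 1 then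
            (X : Polynomial ℤ) ^ f (n + 1 + 1) (app (app w y) x) else 0)
            = X ^ (e (γ + Pi.single y 1) x y) * ∑ w : Fin n → Fin m,
              if wcontent w = γ then (X : Polynomial ℤ) ^ f (n + 1) (app w y) else 0 := by
          rw [Finset.mul_sum]
          refine Finset.sum_congr rfl fun w _ => ?_
          rw [hf, wcontent_app]
          by_cases h : wcontent w = γ
          · simp [h, pow_add, mul_comm]
          · simp [h]
        have h2 : ∑ z ∈ Finset.Ioi y, (γ + Pi.single y 1 : Fin m → ℕ) z = ∑ z ∈ Finset.Ioi y, γ z := by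
          refine Finset.sum_congr rfl fun z hz => ?_
          have : z ≠ y := (Finset.mem_Ioi.1 hz).ne'
          simp [this]
        have h3 := ih γ hγ y
        rw [h1, h2, prod_qfact_add]
        have h4 : (γ + Pi.single y 1 : Fin m → ℕ) y = γ y + 1 := by simp
        rw [h4]
        calc _ = X ^ (e (γ + Pi.single y 1) x y) * qint (γ y + 1) *
              ((∑ w : Fin n → Fin m,
              if wcontent w = γ then (X : Polynomial ℤ) ^ f (n + 1) (app w y) else 0)
              * ∏ a, qfact (γ a)) := by ring
          _ = _ := by rw [h3]; ring
    rw [Finset.sum_congr rfl fun y _ => key y, ← Finset.sum_mul, he, hβ, qfact_succ_mul]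
    ring

lemma inv_words {m n : ℕ} (β : Fin (m + 1) → ℕ) (hβ : ∑ a, β a = n) :
    (∑ w : Fin n → Fin (m + 1), if wcontent w = β then (X : Polynomial ℤ) ^ inv w else 0)
      * ∏ a, qfact (β a) = qfact n := by
  have h := generic (m := m + 1) (fun n w => inv w)
    (fun β x _ => ∑ z ∈ Finset.Ioi x, β z)
    (fun w x => by rw [inv_app]; simp [inv, wcontent])
    (fun n w y x => by rw [inv_app (app w y)])
    (fun β x => by rw [← Finset.mul_sum, qint_sum_univ])
    n β hβ (Fin.last m)
  have e : Finset.Ioi (Fin.last m) = ∅ := by ext z; simp [Fin.le_last]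
  simpa [inv_app, e] using h

lemma maj_words {m n : ℕ} (β : Fin (m + 1) → ℕ) (hβ : ∑ a, β a = n) :
    (∑ w : Fin n → Fin (m + 1), if wcontent w = β then (X : Polynomial ℤ) ^ maj w else 0)
      * ∏ a, qfact (β a) = qfact n := by
  have h := generic (m := m + 1) (fun n w => maj w)
    (fun β x y => if x < y then ∑ y, β y else 0)
    (fun w x => by rw [maj_eq_sum]; simp)
    (fun n w y x => by
      rw [maj_app_app, wcontent_sum]; simp)
    (fun β x => qint_sum_split β x)
    n β hβ (Fin.last m)
  have e : Finset.Ioi (Fin.last m) = ∅ := by ext z; simp [Fin.le_last]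
  simpa [maj_app_top, e] using h

/-! ### From permutations to words -/

lemma inv_symm {n : ℕ} (π : Equiv.Perm (Fin n)) :
    inv (fun i => (π i : ℕ)) = inv (fun i => (π.symm i : ℕ)) := by
  unfold inv
  refine Finset.card_bij' (fun p _ => (π p.2, π p.1)) (fun p _ => (π.symm p.2, π.symm p.1))
    ?_ ?_ ?_ ?_ <;> simp +contextual

lemma stats_comp {n m : ℕ} (σ : Equiv.Perm (Fin n)) (b : Fin n → Fin m) (hb : Monotone b)
    (h : ∀ i j, i < j → b i = b j → σ.symm i < σ.symm j) :
    inv (fun i => (σ i : ℕ)) = inv (b ∘ σ) ∧ maj (fun i => (σ i : ℕ)) = maj (b ∘ σ) := by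
  have key : ∀ i j, i < j → ((σ j : ℕ) < (σ i : ℕ) ↔ (b ∘ σ) j < (b ∘ σ) i) := by
    intro i j hij
    constructor
    · intro hlt
      have hlt' : σ j < σ i := hlt
      refine lt_of_le_of_ne (hb hlt'.le) fun heq => ?_
      have := h _ _ hlt' heq
      simp only [Equiv.symm_apply_apply] at this
      exact absurd this (not_lt.2 hij.le)
    · intro hlt
      by_contra hcon
      exact absurd hlt (not_lt.2 (hb (not_lt.1 hcon)))
  constructor
  · unfold inv
    congr 1
    ext p
    simp only [Finset.mem_filter, Finset.mem_univ, true_and]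
    exact and_congr_right fun hp => key _ _ hp
  · unfold maj
    refine Finset.sum_congr ?_ fun _ _ => rfl
    ext p
    simp only [Finset.mem_filter, Finset.mem_univ, true_and]
    refine and_congr_right fun hp => key _ _ ?_
    rw [Fin.lt_def]; omega

lemma exists_perm_of_content {n m : ℕ} (w b : Fin n → Fin m) (h : wcontent w = wcontent b) :
    ∃ σ : Equiv.Perm (Fin n), w = b ∘ σ := by
  have hc : ∀ a, Fintype.card {i // w i = a} = Fintype.card {i // b i = a} := by
    intro a
    have := congrFun h a
    simpa [wcontent, Fintype.card_subtype] using this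
  let e := fun a => Fintype.equivOfCardEq (hc a)
  refine ⟨(Equiv.sigmaFiberEquiv w).symm.trans
    ((Equiv.sigmaCongrRight e).trans (Equiv.sigmaFiberEquiv b)), ?_⟩
  funext i
  exact (e (w i) ⟨i, rfl⟩).2.symm

lemma wcontent_comp_perm {n m : ℕ} (b : Fin n → Fin m) (σ : Equiv.Perm (Fin n)) :
    wcontent (b ∘ σ) = wcontent b := by
  funext a
  exact Equiv.sum_comp σ (fun i => if b i = a then 1 else 0)

/-- The sum over permutations increasing on the fibres of `b` becomes a sum over words. -/
lemma sum_perm_eq_sum_words {n m : ℕ} (b : Fin n → Fin m) (hb : Monotone b)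
    (P : Equiv.Perm (Fin n) → Prop) [DecidablePred P]
    (hP : ∀ π, P π ↔ ∀ i j, i < j → b i = b j → π i < π j)
    (F : Equiv.Perm (Fin n) → Polynomial ℤ) (G : (Fin n → Fin m) → Polynomial ℤ)
    (hFG : ∀ π, P π → F π = G (b ∘ π.symm)) :
    ∑ π ∈ Finset.univ.filter P, F π = ∑ w, if wcontent w = wcontent b then G w else 0 := by
  rw [← Finset.sum_filter]
  have hsort : ∀ π, P π → Tuple.sort (b ∘ π.symm) = π := by
    intro π hπ
    symm
    rw [Tuple.eq_sort_iff]
    constructor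
    · simpa [Function.comp_assoc] using hb
    · intro i j hij h
      exact (hP π).1 hπ i j hij (by simpa using h)
  have hw : ∀ w : Fin n → Fin m, wcontent w = wcontent b → w ∘ Tuple.sort w = b := by
    intro w hwc
    obtain ⟨σ, rfl⟩ := exists_perm_of_content w b hwc
    rw [Tuple.comp_perm_comp_sort_eq_comp_sort, Tuple.sort_eq_refl_iff_monotone.2 hb]
    rfl
  refine Finset.sum_bij' (fun π _ => b ∘ π.symm) (fun w _ => Tuple.sort w) ?_ ?_ ?_ ?_ ?_
  · intro π _
    simp only [Finset.mem_filter, Finset.mem_univ, true_and]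
    exact wcontent_comp_perm b π.symm
  · intro w h
    simp only [Finset.mem_filter, Finset.mem_univ, true_and] at h ⊢
    rw [hP]
    intro i j hij hbij
    refine ((Tuple.eq_sort_iff (f := w)).1 rfl).2 i j hij ?_
    have := hw w h
    rw [← this] at hbij
    exact hbij
  · intro π h
    exact hsort π (by simpa using h)
  · intro w h
    have h' := hw w (by simpa using h)
    funext i
    have := congrFun h' ((Tuple.sort w).symm i)
    simpa using this.symm
  · intro π h
    exact hFG π (by simpa using h)

/-! ### The block function -/

/-- The block (0-based) to which a position belongs. -/
def blk (n k : ℕ) (s : ℕ → ℕ) (i : Fin n) : Fin (k + 1) :=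
  ⟨((Finset.Icc 1 k).filter (fun j => s j ≤ (i : ℕ))).card, by
    refine Nat.lt_succ_of_le ((Finset.card_filter_le _ _).trans ?_)
    simp⟩

lemma blk_monotone (n k : ℕ) (s : ℕ → ℕ) : Monotone (blk n k s) := by
  intro i j hij
  simp only [blk, Fin.mk_le_mk]
  refine Finset.card_le_card fun a ha => ?_
  simp only [Finset.mem_filter] at ha ⊢
  exact ⟨ha.1, ha.2.trans hij⟩

lemma s_mono (k : ℕ) (s : ℕ → ℕ) (hmono : ∀ j ≤ k, s j < s (j + 1)) (a b : ℕ)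
    (hab : a ≤ b) (hb : b ≤ k + 1) : s a ≤ s b := by
  induction b, hab using Nat.le_induction with
  | base => exact le_rfl
  | succ b _ ih => exact (ih (by omega)).trans (hmono b (by omega)).le

lemma blk_of_mem (n k : ℕ) (s : ℕ → ℕ) (hmono : ∀ j ≤ k, s j < s (j + 1)) (i : Fin n)
    (a : ℕ) (ha : a ≤ k) (h1 : s a ≤ i) (h2 : (i : ℕ) < s (a + 1)) :
    (blk n k s i : ℕ) = a := by
  have : (Finset.Icc 1 k).filter (fun j => s j ≤ (i : ℕ)) = Finset.Icc 1 a := by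
    ext j
    simp only [Finset.mem_filter, Finset.mem_Icc]
    constructor
    · rintro ⟨⟨h3, h4⟩, h5⟩
      refine ⟨h3, ?_⟩
      by_contra hc
      have := s_mono k s hmono (a + 1) j (by omega) (by omega)
      omega
    · rintro ⟨h3, h4⟩
      exact ⟨⟨h3, h4.trans ha⟩, (s_mono k s hmono j a h4 (by omega)).trans h1⟩
  simp [blk, this]

lemma exists_block (k : ℕ) (s : ℕ → ℕ) (hs0 : s 0 = 0) (i : ℕ) (hi : i < s (k + 1)) :
    ∃ a ≤ k, s a ≤ i ∧ i < s (a + 1) := by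
  induction k with
  | zero => exact ⟨0, le_rfl, by omega, hi⟩
  | succ k ih =>
    by_cases h : i < s (k + 1)
    · obtain ⟨a, ha, h'⟩ := ih h
      exact ⟨a, by omega, h'⟩
    · exact ⟨k + 1, le_rfl, by omega, hi⟩

lemma blk_eq_iff (n k : ℕ) (s : ℕ → ℕ)
    (hs0 : s 0 = 0) (hsn : s (k + 1) = n) (hmono : ∀ j ≤ k, s j < s (j + 1)) (i : Fin n)
    (a : Fin (k + 1)) : blk n k s i = a ↔ s a ≤ i ∧ (i : ℕ) < s (a + 1) := by
  constructor
  · rintro rfl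
    obtain ⟨a, ha, h1, h2⟩ := exists_block k s hs0 i (by rw [hsn]; exact i.2)
    rw [blk_of_mem n k s hmono i a ha h1 h2]
    exact ⟨h1, h2⟩
  · rintro ⟨h1, h2⟩
    exact Fin.ext (blk_of_mem n k s hmono i a (by omega) h1 h2)

lemma wcontent_blk (n k : ℕ) (s : ℕ → ℕ)
    (hs0 : s 0 = 0) (hsn : s (k + 1) = n) (hmono : ∀ j ≤ k, s j < s (j + 1))
    (a : Fin (k + 1)) : wcontent (blk n k s) a = s (a + 1) - s a := by
  simp only [wcontent, blk_eq_iff n k s hs0 hsn hmono]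
  have hle := s_mono k s hmono (a + 1) (k + 1) (by omega) le_rfl
  rw [Fin.sum_univ_eq_sum_range (fun i => if s a ≤ i ∧ i < s (a + 1) then 1 else 0) n,
    ← Finset.card_filter, ← Nat.card_Ico]
  congr 1
  ext i
  simp only [Finset.mem_filter, Finset.mem_range, Finset.mem_Ico]
  omega

lemma desSubset_iff (n k : ℕ) (s : ℕ → ℕ)
    (hs0 : s 0 = 0) (hsn : s (k + 1) = n) (hmono : ∀ j ≤ k, s j < s (j + 1))
    (π : Equiv.Perm (Fin n)) :
    DesSubset n k s π ↔ ∀ i j, i < j → blk n k s i = blk n k s j → π i < π j := by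
  constructor
  · intro h
    have key : ∀ d : ℕ, ∀ i j : Fin n, (j : ℕ) = i + d + 1 → blk n k s i = blk n k s j →
        π i < π j := by
      intro d
      induction d with
      | zero =>
        intro i j hij hb
        by_contra hcon
        have hne : π j ≠ π i := by
          intro he
          have := π.injective he
          subst this
          omega
        obtain ⟨t, ht, hst⟩ := h (i, j) hij (lt_of_le_of_ne (not_lt.1 hcon) hne)
        simp only [Finset.mem_Icc] at ht hst
        have hi := (blk_eq_iff n k s hs0 hsn hmono i _).1 rfl
        have hj := (blk_eq_iff n k s hs0 hsn hmono j _).1 hb.symm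
        have hlt := (blk n k s i).2
        rcases Nat.lt_or_ge (blk n k s i : ℕ) t with h1 | h1
        · have := s_mono k s hmono (blk n k s i + 1) t (by omega) (by omega)
          omega
        · have := s_mono k s hmono t (blk n k s i) (by omega) (by omega)
          omega
      | succ d ih =>
        intro i j hij hb
        have hm : (i : ℕ) + d + 1 < n := by omega
        have h1 := blk_monotone n k s (show i ≤ ⟨i + d + 1, hm⟩ by rw [Fin.le_def]; simp; omega)
        have h2 := blk_monotone n k s (show (⟨i + d + 1, hm⟩ : Fin n) ≤ j by
          rw [Fin.le_def]; simp; omega)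
        have h3 : blk n k s i = blk n k s ⟨i + d + 1, hm⟩ := le_antisymm h1 (hb ▸ h2)
        refine (ih i ⟨i + d + 1, hm⟩ rfl h3).trans ?_
        by_contra hcon
        have hne : π j ≠ π ⟨i + d + 1, hm⟩ := by
          intro he
          have := congrArg Fin.val (π.injective he)
          simp at this
          omega
        obtain ⟨t, ht, hst⟩ := h (⟨i + d + 1, hm⟩, j) (by simp; omega)
          (lt_of_le_of_ne (not_lt.1 hcon) hne)
        simp only [Finset.mem_Icc] at ht hst
        have hi := (blk_eq_iff n k s hs0 hsn hmono i _).1 rfl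
        have hj := (blk_eq_iff n k s hs0 hsn hmono j _).1 hb.symm
        have hlt := (blk n k s i).2
        rcases Nat.lt_or_ge (blk n k s i : ℕ) t with h1 | h1
        · have := s_mono k s hmono (blk n k s i + 1) t (by omega) (by omega)
          omega
        · have := s_mono k s hmono t (blk n k s i) (by omega) (by omega)
          omega
    intro i j hij
    exact key (j - i - 1) i j (by rw [Fin.lt_def] at hij; omega)
  · rintro h ⟨i, j⟩ hij hlt
    simp only at hij hlt ⊢
    have hij' : i < j := by rw [Fin.lt_def]; omega
    have hne : blk n k s i ≠ blk n k s j := fun he => absurd hlt (not_lt.2 (h i j hij' he).le)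
    have hlt' := lt_of_le_of_ne (blk_monotone n k s hij'.le) hne
    have hi := (blk_eq_iff n k s hs0 hsn hmono i _).1 rfl
    have hj := (blk_eq_iff n k s hs0 hsn hmono j _).1 rfl
    have hjlt := (blk n k s j).2
    rw [Fin.lt_def] at hlt'
    refine ⟨blk n k s j, by simp only [Finset.mem_Icc]; omega, ?_⟩
    have := s_mono k s hmono (blk n k s i + 1) (blk n k s j) (by omega) (by omega)
    omega

/-- for `S = {s 1 < … < s k} ⊆ [n−1]` (with `s 0 = 0`, `s (k+1) = n`),
`inv` and `imaj` are equidistributed on `{π ∈ S_n : Des(π) ⊆ S}`, with common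
generating function the `q`-multinomial coefficient
`[n]!_q / ([s 1 - s 0]!_q ⋯ [s (k+1) - s k]!_q)` (stated multiplied through by the
denominator). -/
theorem inv_imaj_equidistributed_des_subset (n k : ℕ) (s : ℕ → ℕ)
    (hs0 : s 0 = 0) (hsn : s (k + 1) = n) (hmono : ∀ j ≤ k, s j < s (j + 1)) :
    (∑ π ∈ Finset.univ.filter (DesSubset n k s),
        (X : Polynomial ℤ) ^ inv (fun i => (π i : ℕ)) =
      ∑ π ∈ Finset.univ.filter (DesSubset n k s),
        (X : Polynomial ℤ) ^ maj (fun i => (π.symm i : ℕ))) ∧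
    (∑ π ∈ Finset.univ.filter (DesSubset n k s),
        (X : Polynomial ℤ) ^ inv (fun i => (π i : ℕ))) *
      ∏ j ∈ Finset.Icc 1 (k + 1), qfact (s j - s (j - 1)) = qfact n := by
  have hP := desSubset_iff n k s hs0 hsn hmono
  have hb := blk_monotone n k s
  have hstats : ∀ π : Equiv.Perm (Fin n), DesSubset n k s π →
      inv (fun i => (π.symm i : ℕ)) = inv (blk n k s ∘ π.symm) ∧
      maj (fun i => (π.symm i : ℕ)) = maj (blk n k s ∘ π.symm) := fun π hπ =>
    stats_comp π.symm (blk n k s) hb (by simpa using (hP π).1 hπ)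
  have hI := sum_perm_eq_sum_words (blk n k s) hb (DesSubset n k s) hP
    (fun π => (X : Polynomial ℤ) ^ inv (fun i => (π i : ℕ))) (fun w => X ^ inv w)
    (fun π hπ => by simp only [inv_symm π, (hstats π hπ).1])
  have hM := sum_perm_eq_sum_words (blk n k s) hb (DesSubset n k s) hP
    (fun π => (X : Polynomial ℤ) ^ maj (fun i => (π.symm i : ℕ))) (fun w => X ^ maj w)
    (fun π hπ => by simp only [(hstats π hπ).2])
  have hsum : ∑ a, wcontent (blk n k s) a = n := by
    rw [wcontent_sum]; simp
  have h1 := inv_words (wcontent (blk n k s)) hsum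
  have h2 := maj_words (wcontent (blk n k s)) hsum
  rw [← hI] at h1
  rw [← hM] at h2
  have hprod : ∏ a, qfact (wcontent (blk n k s) a)
      = ∏ j ∈ Finset.Icc 1 (k + 1), qfact (s j - s (j - 1)) := by
    simp only [wcontent_blk n k s hs0 hsn hmono]
    rw [Fin.prod_univ_eq_prod_range (fun a => qfact (s (a + 1) - s a)) (k + 1),
      Finset.range_eq_Ico]
    exact Finset.prod_Ico_add' (fun j => qfact (s j - s (j - 1))) 0 (k + 1) 1
  have hne : ∏ a, qfact (wcontent (blk n k s) a) ≠ 0 :=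
    Finset.prod_ne_zero_iff.2 fun a _ => qfact_ne_zero _
  exact ⟨mul_right_cancel₀ hne (h1.trans h2.symm), by rw [← hprod]; exact h1⟩
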